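/- Let P be a submonoid of a group G, let p₁, q₁, …, p_n, q_n ∈ P, set W = V_{p₁}* V_{q₁} ⋯ V_{p_n}* V_{q_n} (a bounded operator on ℓ²(P)) and g = p₁⁻¹q₁ ⋯ p_n⁻¹q_n ∈ G (product computed in G). Then for every s ∈ P, either W δ_s = 0, or gs ∈ P and W δ_s = δ_{gs}. -/

import Mathlib

noncomputable section

open ContinuousLinearMap
open scoped Classical

variable {G : Type*} [Group G]

/-- The Hilbert space ℓ²(P). -/
abbrev l2 (P : Submonoid G) : Type _ := lp (fun _ : P => ℂ) 2

/-- The standard orthonormal basis vector δ_s of ℓ²(P). -/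
def delta (P : Submonoid G) (s : P) : l2 P :=
  letI := Classical.decEq P
  lp.single 2 s 1

/-- The set pX = {px : x ∈ X}. -/
def lmul (P : Submonoid G) (p : P) (X : Set P) : Set P := (fun x => p * x) '' X

/-- The set p⁻¹X = {y ∈ P : py ∈ X}. -/
def linv (P : Submonoid G) (p : P) (X : Set P) : Set P := {y : P | p * y ∈ X}

/-- The set p₁⁻¹q₁ ⋯ pₙ⁻¹qₙ X, the operations being applied iteratively from the right;
the word is encoded as the list [(p₁,q₁),…,(pₙ,qₙ)]. -/
def wordSet (P : Submonoid G) (l : List (P × P)) (X : Set P) : Set P :=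
  l.foldr (fun a Y => linv P a.1 (lmul P a.2 Y)) X

/-- The operator V_{p₁}* V_{q₁} ⋯ V_{pₙ}* V_{qₙ} on ℓ²(P), the word being encoded as the
list [(p₁,q₁),…,(pₙ,qₙ)]. -/
def opWord (P : Submonoid G) (V : P → (l2 P →L[ℂ] l2 P)) (l : List (P × P)) :
    l2 P →L[ℂ] l2 P :=
  (l.map fun a => (ContinuousLinearMap.adjoint (V a.1)) * (V a.2)).prod

/-- The group element p₁⁻¹q₁ ⋯ pₙ⁻¹qₙ of G. -/
def grpWord (P : Submonoid G) (l : List (P × P)) : G :=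
  (l.map fun a => ((a.1 : G))⁻¹ * (a.2 : G)).prod

theorem inner_delta_left (P : Submonoid G) (t : P) (f : l2 P) :
    inner ℂ (delta P t) f = f t := by
  simp [delta, lp.inner_single_left]

theorem delta_apply (P : Submonoid G) (s t : P) :
    delta P s t = if t = s then 1 else 0 := by
  simp [delta, Pi.single_apply]

theorem adjoint_apply_coord (P : Submonoid G) (T : l2 P →L[ℂ] l2 P) (p : P)
    (hT : ∀ s : P, T (delta P s) = delta P (p * s)) (f : l2 P) (t : P) :
    adjoint T f t = f (p * t) := by
  rw [← inner_delta_left, adjoint_inner_right, hT, inner_delta_left]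

theorem adjoint_delta_mul (P : Submonoid G) (T : l2 P →L[ℂ] l2 P) (p : P)
    (hT : ∀ s : P, T (delta P s) = delta P (p * s)) (y : P) :
    adjoint T (delta P (p * y)) = delta P y := by
  ext t
  rw [adjoint_apply_coord P T p hT, delta_apply, delta_apply]
  simp

theorem adjoint_delta_eq_zero (P : Submonoid G) (T : l2 P →L[ℂ] l2 P) (p : P)
    (hT : ∀ s : P, T (delta P s) = delta P (p * s)) (r : P) (hr : ∀ y : P, p * y ≠ r) :
    adjoint T (delta P r) = 0 := by
  ext t
  rw [adjoint_apply_coord P T p hT, delta_apply, if_neg (hr t)]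
  rfl

theorem opWord_delta (P : Submonoid G) (V : P → (l2 P →L[ℂ] l2 P))
    (hV : ∀ p s : P, V p (delta P s) = delta P (p * s)) (l : List (P × P)) (s : P) :
    opWord P V l (delta P s) = 0
      ∨ ∃ h : grpWord P l * (s : G) ∈ P,
          opWord P V l (delta P s) = delta P ⟨grpWord P l * (s : G), h⟩ := by
  induction l with
  | nil => exact Or.inr ⟨by simp [grpWord], by simp [opWord, grpWord]⟩
  | cons a l ih =>
    have hop : opWord P V (a :: l) (delta P s)
        = adjoint (V a.1) (V a.2 (opWord P V l (delta P s))) := by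
      simp [opWord]
    have hgrp : grpWord P (a :: l) = (a.1 : G)⁻¹ * a.2 * grpWord P l := by
      simp [grpWord]
    rw [hop]
    rcases ih with h0 | ⟨h, hs⟩
    · left
      rw [h0, map_zero, map_zero]
    · rw [hs, hV]
      by_cases hy : ∃ y : P, a.1 * y = a.2 * ⟨grpWord P l * (s : G), h⟩
      · obtain ⟨y, hy⟩ := hy
        have hyG : grpWord P (a :: l) * (s : G) = y := by
          have hcoe : (a.1 : G) * y = a.2 * (grpWord P l * s) := congrArg Subtype.val hy
          rw [hgrp, mul_assoc, mul_assoc, ← hcoe, inv_mul_cancel_left]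
        refine Or.inr ⟨hyG ▸ y.2, ?_⟩
        rw [← hy, adjoint_delta_mul P (V a.1) a.1 (hV a.1)]
        exact congrArg (delta P) (Subtype.ext hyG.symm)
      · exact Or.inl (adjoint_delta_eq_zero P (V a.1) a.1 (hV a.1) _ (not_exists.mp hy))

/-- For W = V_{p₁}* V_{q₁} ⋯ V_{pₙ}* V_{qₙ} and g = p₁⁻¹q₁ ⋯ pₙ⁻¹qₙ ∈ G, and any s ∈ P:
either W δ_s = 0, or gs ∈ P and W δ_s = δ_{gs}. -/
theorem stmt8 (P : Submonoid G)
    (V : P → (l2 P →L[ℂ] l2 P))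
    (hV : ∀ p s : P, V p (delta P s) = delta P (p * s))
    (n : ℕ) (p q : Fin n → P) (s : P) :
    opWord P V (List.ofFn fun i => (p i, q i)) (delta P s) = 0
      ∨ ∃ h : grpWord P (List.ofFn fun i => (p i, q i)) * (s : G) ∈ P,
          opWord P V (List.ofFn fun i => (p i, q i)) (delta P s)
            = delta P ⟨grpWord P (List.ofFn fun i => (p i, q i)) * (s : G), h⟩ :=
  opWord_delta P V hV _ s
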